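/- arXiv:1511.07729 — 2 statements merged into one kernel-verified Lean document; each statement's English description precedes it below -/
import Mathlib

section
/- Every monotone order-oblivious protocol for the communication game G_n has cost at least ⌊√n⌋; that is, the edge set E(Π) of the protocol, viewed as a subgraph of the hypercube {0,1}^n, contains a vertex of degree at least ⌊√n⌋. -/
/-- The partial assignment written by an order-oblivious protocol `B` after `t` steps of
the stream `σ` (the element arriving at time `t` is `σ t`; `B ℓ α` is the bit Alice writes
at an arriving location `ℓ` when the current partial assignment is `α`). -/
def partOO {n : ℕ} (B : Fin n → (Fin n → Option Bool) → Bool) (σ : Equiv.Perm (Fin n)) :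
    ℕ → (Fin n → Option Bool)
  | 0 => fun _ => none
  | t + 1 =>
    if h : t < n then
      Function.update (partOO B σ t) (σ ⟨t, h⟩) (some (B (σ ⟨t, h⟩) (partOO B σ t)))
    else partOO B σ t

/-- The bit written by the order-oblivious protocol `B` at location `ℓ` on stream `σ`. -/
def writeOO {n : ℕ} (B : Fin n → (Fin n → Option Bool) → Bool) (σ : Equiv.Perm (Fin n))
    (ℓ : Fin n) : Bool :=
  B ℓ (partOO B σ ((σ.symm ℓ : ℕ)))

/-- The hypercube edge `Π_A(σ)`: the array written after the first `n - 1` steps, with a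
single unfilled (`none`) coordinate at the last location `σ (n-1)`. -/
def edgeOO {n : ℕ} (B : Fin n → (Fin n → Option Bool) → Bool) (σ : Equiv.Perm (Fin n)) :
    Fin n → Option Bool :=
  partOO B σ (n - 1)

/-- `v ∈ {0,1}^n` is an endpoint of the edge `e` (with `*` encoded as `none`). -/
def Compatible {n : ℕ} (v : Fin n → Bool) (e : Fin n → Option Bool) : Prop :=
  ∀ ℓ b, e ℓ = some b → v ℓ = b

/-- The degree of the vertex `v` in the graph `E(Π)` of the order-oblivious protocol `B`. -/
noncomputable def degOO {n : ℕ} (B : Fin n → (Fin n → Option Bool) → Bool)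
    (v : Fin n → Bool) : ℕ :=
  {e : Fin n → Option Bool | (∃ σ : Equiv.Perm (Fin n), edgeOO B σ = e) ∧
    Compatible v e}.ncard

/-- `β` extends `α` as a partial assignment. -/
def OExtends {n : ℕ} (α β : Fin n → Option Bool) : Prop :=
  ∀ ℓ b, α ℓ = some b → β ℓ = some b

/-- The protocol `B` is monotone: each map `A_ℓ` is monotone w.r.t. the extension order. -/
def MonotoneOO {n : ℕ} (B : Fin n → (Fin n → Option Bool) → Bool) : Prop :=
  ∀ (ℓ : Fin n) (α β : Fin n → Option Bool), OExtends α β → B ℓ α = true → B ℓ β = true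

/-- Run the protocol on a list (last element of the list arrives first). -/
def runL {n : ℕ} (B : Fin n → (Fin n → Option Bool) → Bool) :
    List (Fin n) → (Fin n → Option Bool)
  | [] => fun _ => none
  | a :: l => Function.update (runL B l) a (some (B a (runL B l)))

/-- Partial assignment: zeros on `Z`, ones on `O`. -/
def asg {n : ℕ} (Z O : Finset (Fin n)) : Fin n → Option Bool :=
  fun x => if x ∈ Z then some false else if x ∈ O then some true else none

/-- Reachable partial assignments. -/
def Reach {n : ℕ} (B : Fin n → (Fin n → Option Bool) → Bool) (α : Fin n → Option Bool) : Prop :=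
  ∃ l : List (Fin n), l.Nodup ∧ runL B l = α

/-- Sets which can be filled by zeros. -/
inductive ZR {n : ℕ} (B : Fin n → (Fin n → Option Bool) → Bool) : Finset (Fin n) → Prop
  | empty : ZR B ∅
  | step (a : Fin n) (Z : Finset (Fin n)) : a ∉ Z → B a (asg Z ∅) = false → ZR B Z →
      ZR B (insert a Z)

/-- The edge at `v` in direction `c`. -/
def edgeAt {n : ℕ} (v : Fin n → Bool) (c : Fin n) : Fin n → Option Bool :=
  fun x => if x = c then none else some (v x)

lemma runL_none {n : ℕ} (B : Fin n → (Fin n → Option Bool) → Bool) (l : List (Fin n)) (x : Fin n) :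
    runL B l x = none ↔ x ∉ l := by
  induction l with
  | nil => simp [runL]
  | cons a l ih =>
    by_cases h : x = a
    · subst h; simp [runL]
    · simp [runL, Function.update_of_ne h, ih, h]

lemma Reach.step {n : ℕ} {B : Fin n → (Fin n → Option Bool) → Bool} {α : Fin n → Option Bool}
    (h : Reach B α) (x : Fin n) (hx : α x = none) :
    Reach B (Function.update α x (some (B x α))) := by
  obtain ⟨l, hl, rfl⟩ := h
  exact ⟨x :: l, List.nodup_cons.2 ⟨(runL_none B l x).1 hx, hl⟩, rfl⟩

lemma ZR.reach {n : ℕ} {B : Fin n → (Fin n → Option Bool) → Bool} {Z : Finset (Fin n)}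
    (h : ZR B Z) : Reach B (asg Z ∅) := by
  induction h with
  | empty => exact ⟨[], List.nodup_nil, by funext x; simp [runL, asg]⟩
  | step a Z ha hB _ ih =>
    have := ih.step a (by simp [asg, ha])
    rw [hB] at this
    convert this using 1
    funext x
    by_cases h : x = a
    · subst h; simp [asg]
    · simp [asg, Function.update_of_ne h, h]

lemma asg_ext {n : ℕ} {Z Z' O O' : Finset (Fin n)} (hZ : Z' ⊆ Z) (hO : O' ⊆ O)
    (hd : Disjoint Z O) : OExtends (asg Z' O') (asg Z O) := by
  intro x b h
  have h3 : x ∈ O → x ∉ Z := fun h1 h2 => Finset.disjoint_left.1 hd h2 h1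
  have h1 := @hZ x
  have h2 := @hO x
  unfold asg at *
  grind

lemma ZR.mono {n : ℕ} {B : Fin n → (Fin n → Option Bool) → Bool} (hB : MonotoneOO B)
    {Z : Finset (Fin n)} (h : ZR B Z) : ∀ Z' ⊆ Z, ZR B Z' := by
  induction h with
  | empty => intro Z' h; rw [Finset.subset_empty.1 h]; exact ZR.empty
  | step a Z ha h0 _ ih =>
    intro Z' hZ'
    have hsub : Z'.erase a ⊆ Z := by
      intro x hx
      have := hZ' (Finset.mem_of_mem_erase hx)
      have := Finset.ne_of_mem_erase hx
      grind
    by_cases hm : a ∈ Z'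
    · rw [← Finset.insert_erase hm]
      refine ZR.step a _ (by simp) ?_ (ih _ hsub)
      by_contra hc
      have := hB a _ _ (asg_ext hsub (Finset.Subset.refl ∅) (by simp)) (by simpa using hc)
      simp [h0] at this
    · rw [← Finset.erase_eq_of_notMem hm]
      exact ih _ hsub

lemma reach_ones {n : ℕ} {B : Fin n → (Fin n → Option Bool) → Bool} (hB : MonotoneOO B)
    {Z : Finset (Fin n)} (h : ZR B Z) (O : Finset (Fin n)) (hd : Disjoint Z O)
    (hO : ∀ r ∈ O, B r (asg Z ∅) = true) : Reach B (asg Z O) := by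
  induction O using Finset.induction_on with
  | empty => exact h.reach
  | insert a O ha ih =>
    rw [Finset.disjoint_insert_right] at hd
    have h1 := (ih hd.2 (fun r hr => hO r (Finset.mem_insert_of_mem hr))).step a
      (by simp [asg, ha, hd.1])
    rw [hB a _ _ (asg_ext (Finset.Subset.refl Z) (Finset.empty_subset O) hd.2)
      (hO a (Finset.mem_insert_self a O))] at h1
    convert h1 using 1
    funext x
    by_cases h : x = a
    · subst h; simp [asg, hd.1]
    · simp [asg, Function.update_of_ne h, h]

lemma part_eq {n : ℕ} (B : Fin n → (Fin n → Option Bool) → Bool) (σ : Equiv.Perm (Fin n))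
    (l : List (Fin n)) (hl : l.length = n)
    (hσ : ∀ (t : ℕ) (h : t < n), σ ⟨t, h⟩ = l[n - 1 - t]'(by omega)) (t : ℕ) (ht : t ≤ n) :
    partOO B σ t = runL B (l.drop (n - t)) := by
  induction t with
  | zero => simp [partOO, ← hl, runL]
  | succ t ih =>
    have h : t < n := ht
    have e : l.drop (n - (t+1)) = l[n - 1 - t]'(by omega) :: l.drop (n - t) := by
      have h2 : n - (t+1) = n - 1 - t := by omega
      have h3 : n - t = n - 1 - t + 1 := by omega
      rw [h2, h3]
      exact List.drop_eq_getElem_cons (by omega)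
    rw [e, runL, partOO, dif_pos h, ih h.le, hσ t h]

lemma reach_edge {n : ℕ} {B : Fin n → (Fin n → Option Bool) → Bool} (v : Fin n → Bool) (c : Fin n)
    (h : Reach B (edgeAt v c)) : ∃ σ : Equiv.Perm (Fin n), edgeOO B σ = edgeAt v c := by
  obtain ⟨l, hl, he⟩ := h
  have hmem : ∀ x, x ∉ l ↔ x = c := by
    intro x
    rw [← runL_none B l x, he]
    simp [edgeAt]
  have hnd : (c :: l).Nodup := List.nodup_cons.2 ⟨(hmem c).2 rfl, hl⟩
  have hall : ∀ x, x ∈ c :: l := by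
    intro x
    by_cases hx : x = c
    · simp [hx]
    · have := (not_congr (hmem x)).2 hx
      simp only [not_not] at this
      exact List.mem_cons_of_mem _ this
  have hlen : (c :: l).length = n := by
    rw [← List.toFinset_card_of_nodup hnd]
    have : (c :: l).toFinset = Finset.univ := by
      ext x; simpa using hall x
    rw [this]; simp
  have hn : 0 < n := c.pos
  let f : Fin n → Fin n := fun t => (c :: l)[n - 1 - t.1]'(by omega)
  have hf : Function.Injective f := by
    intro a b hab
    have := (hnd.getElem_inj_iff).1 hab
    ext
    omega
  refine ⟨Equiv.ofBijective f (Finite.injective_iff_bijective.1 hf), ?_⟩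
  unfold edgeOO
  rw [part_eq B _ (c :: l) hlen (fun t h => rfl) (n - 1) (by omega), ← he]
  have : n - (n - 1) = 1 := by omega
  rw [this]; rfl

lemma deg_ge {n : ℕ} {B : Fin n → (Fin n → Option Bool) → Bool} (v : Fin n → Bool)
    (C : Finset (Fin n)) (h : ∀ c ∈ C, Reach B (edgeAt v c)) : C.card ≤ degOO B v := by
  have hinj : Function.Injective (edgeAt v) := by
    intro a b hab
    have := congrFun hab a
    by_contra hne
    simp [edgeAt, hne] at this
  rw [← Set.ncard_coe_finset, ← Set.ncard_image_of_injective _ hinj]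
  refine Set.ncard_le_ncard ?_ (Set.toFinite _)
  rintro _ ⟨c, hc, rfl⟩
  refine ⟨reach_edge v c (h c hc), ?_⟩
  intro x b hx
  unfold edgeAt at hx
  grind

/-- every monotone order-oblivious protocol for the game `G_n` has cost at
least `⌊√n⌋`: some vertex of the hypercube has degree at least `⌊√n⌋` in `E(Π)`. -/
theorem monotone_protocol_lower_bound {n : ℕ} (hn : 1 ≤ n)
    (B : Fin n → (Fin n → Option Bool) → Bool) (hB : MonotoneOO B) :
    ∃ v : Fin n → Bool, Nat.sqrt n ≤ degOO B v := by
  classical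
  set s := Nat.sqrt n with hs
  have hsn : s * s ≤ n := Nat.sqrt_le n
  have hs1 : 1 ≤ s := Nat.le_sqrt.2 (by simpa using hn)
  obtain ⟨Z, hZ, hmax⟩ := Finset.exists_max_image
    (Finset.univ.filter (fun Z : Finset (Fin n) => ZR B Z)) Finset.card
    ⟨∅, by simpa using ZR.empty⟩
  simp only [Finset.mem_filter, Finset.mem_univ, true_and] at hZ hmax
  have hR : ∀ r, r ∉ Z → B r (asg Z ∅) = true := by
    intro r hr
    by_contra hc
    have := hmax _ (ZR.step r Z hr (by simpa using hc) hZ)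
    rw [Finset.card_insert_of_notMem hr] at this
    omega
  by_cases hk : s ≤ Zᶜ.card
  · refine ⟨fun x => decide (x ∉ Z), hk.trans (deg_ge _ _ ?_)⟩
    intro c hc
    have := reach_ones hB hZ (Zᶜ.erase c)
      (Finset.disjoint_left.2 (fun x hx hx' => by simp at hx'; exact hx'.2 hx))
      (fun r hr => hR r (by simp at hr; exact hr.2))
    convert this using 1
    funext x
    simp only [Finset.mem_compl] at hc
    simp only [edgeAt, asg, Finset.mem_erase, Finset.mem_compl]
    grind
  -- colour each `z ∈ Z` by an element outside `Z` for which it is critical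
  let P : Fin n → Fin n → Prop := fun z r => r ∉ Z ∧ B r (asg (Z.erase z) ∅) = false
  let f : Fin n → Option (Fin n) := fun z =>
    if h : ∃ r, P z r then some h.choose else none
  have hfm : ∀ z ∈ Z, f z ∈ insert none (Zᶜ.image some) := by
    intro z _
    by_cases h : ∃ r, P z r
    · have := h.choose_spec.1
      simp [f, dif_pos h, this]
    · simp [f, dif_neg h]
  have hcard : (insert none (Zᶜ.image some) : Finset (Option (Fin n))).card * (s - 1) < Z.card := by
    have h1 : (insert none (Zᶜ.image some) : Finset (Option (Fin n))).card ≤ Zᶜ.card + 1 :=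
      (Finset.card_insert_le _ _).trans (Nat.succ_le_succ Finset.card_image_le)
    have h2 : Z.card + Zᶜ.card = n := by simpa using Finset.card_add_card_compl Z
    have h3 : (insert none (Zᶜ.image some) : Finset (Option (Fin n))).card ≤ s := by omega
    have h4 := Nat.mul_le_mul_right (s - 1) h3
    have h5 : s * (s - 1) + s = s * s := by
      obtain ⟨m, hm⟩ : ∃ m, s = m + 1 := ⟨s - 1, by omega⟩
      rw [hm]; simp; ring
    omega
  obtain ⟨y, hy, hC⟩ := Finset.exists_lt_card_fiber_of_mul_lt_card_of_maps_to hfm hcard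
  have hC' : s ≤ (Z.filter (fun z => f z = y)).card := by omega
  cases y with
  | none =>
    refine ⟨fun x => decide (x ∉ Z), hC'.trans (deg_ge _ _ ?_)⟩
    intro c hc
    rw [Finset.mem_filter] at hc
    have hnp : ¬ ∃ r, P c r := by
      intro h
      have := hc.2
      simp [f, dif_pos h] at this
    have := reach_ones hB (hZ.mono hB (Z.erase c) (Finset.erase_subset c Z)) Zᶜ
      (Finset.disjoint_left.2 (fun x hx hx' => by simp at hx hx'; exact hx' hx.2))
      (fun r hr => by
        by_contra hcon
        exact hnp ⟨r, by simpa using hr, by simpa using hcon⟩)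
    convert this using 1
    funext x
    have := hc.1
    simp only [edgeAt, asg, Finset.mem_erase, Finset.mem_compl]
    grind
  | some r =>
    refine ⟨fun x => decide (x ∉ insert r Z), hC'.trans (deg_ge _ _ ?_)⟩
    intro c hc
    rw [Finset.mem_filter] at hc
    obtain ⟨hcZ, hcf⟩ := hc
    have hP : P c r := by
      by_cases h : ∃ r, P c r
      · have h1 := h.choose_spec
        have h2 : h.choose = r := by simpa [f, dif_pos h] using hcf
        rwa [h2] at h1
      · simp [f, dif_neg h] at hcf
    obtain ⟨hrZ, hr0⟩ := hP
    have hre : r ∉ Z.erase c := fun h => hrZ (Finset.mem_of_mem_erase h)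
    have hZ' : ZR B (insert r (Z.erase c)) :=
      ZR.step r _ hre hr0 (hZ.mono hB (Z.erase c) (Finset.erase_subset c Z))
    have hc' : (insert r (Z.erase c)).card = Z.card := by
      rw [Finset.card_insert_of_notMem hre, Finset.card_erase_add_one hcZ]
    have hd : Disjoint (insert r (Z.erase c)) (insert r Z)ᶜ := by
      rw [Finset.disjoint_left]
      intro x hx hx'
      simp only [Finset.mem_insert, Finset.mem_erase, Finset.mem_compl] at hx hx'
      tauto
    have := reach_ones hB hZ' (insert r Z)ᶜ hd (fun q hq => by
        by_contra hcon
        have hq' : q ∉ insert r (Z.erase c) := fun h => Finset.disjoint_left.1 hd h hq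
        have := hmax _ (ZR.step q _ hq' (by simpa using hcon) hZ')
        rw [Finset.card_insert_of_notMem hq'] at this
        omega)
    convert this using 1
    funext x
    simp only [edgeAt, asg, Finset.mem_erase, Finset.mem_compl, Finset.mem_insert]
    grind
end

section
/- There exists an order-oblivious protocol Π for G_n such that the conditional entropy of σ_n given Alice's output array is at most 3 + ⌈log₂ log₂ n⌉ (for a uniformly random permutation σ and uniform bit b). -/
/-- The Shannon conditional entropy `H(f | g)` (base 2) of random variables `f, g` on a
finite sample space `Ω` with the uniform distribution. -/
noncomputable def condEntropy {Ω X Y : Type*} [Fintype Ω] [Fintype X] [Fintype Y]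
    [DecidableEq X] [DecidableEq Y] (f : Ω → X) (g : Ω → Y) : ℝ :=
  ∑ x : X, ∑ y : Y,
    (fun pxy py : ℝ => if pxy = 0 then 0 else pxy * Real.logb 2 (py / pxy))
      (((Finset.univ.filter fun ω => f ω = x ∧ g ω = y).card : ℝ) / (Fintype.card Ω : ℝ))
      (((Finset.univ.filter fun ω => g ω = y).card : ℝ) / (Fintype.card Ω : ℝ))

/-- Alice's completed array for the order-oblivious protocol `B` on stream `σ` with final
bit `b`. -/
def compOO {n : ℕ} (B : Fin n → (Fin n → Option Bool) → Bool) (σ : Equiv.Perm (Fin n))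
    (b : Bool) : Fin n → Bool :=
  fun ℓ => if (σ.symm ℓ : ℕ) = n - 1 then b else writeOO B σ ℓ

open Finset in
/-- Gibbs' inequality for the conditional entropy. -/
theorem condEntropy_le_cost {Ω X Y : Type*} [Fintype Ω] [Fintype X] [Fintype Y]
    [DecidableEq X] [DecidableEq Y] [Nonempty Ω] (f : Ω → X) (g : Ω → Y) (Q : Y → X → ℝ)
    (hQ0 : ∀ y x, 0 ≤ Q y x) (hQ1 : ∀ y, ∑ x, Q y x ≤ 1) (hQ : ∀ ω, 0 < Q (g ω) (f ω)) :
    condEntropy f g ≤ (∑ ω, - Real.logb 2 (Q (g ω) (f ω))) / (Fintype.card Ω : ℝ) := by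
  classical
  have hN : (0 : ℝ) < Fintype.card Ω := by exact_mod_cast Fintype.card_pos
  set N : ℝ := (Fintype.card Ω : ℝ) with hNdef
  have hl2 : 0 < Real.log 2 := Real.log_pos (by norm_num)
  set c : X → Y → ℝ := fun x y => ((univ.filter fun ω => f ω = x ∧ g ω = y).card : ℝ) with hc
  set d : Y → ℝ := fun y => ((univ.filter fun ω => g ω = y).card : ℝ) with hd
  have hsumc : ∀ F : X → Y → ℝ, ∑ x, ∑ y, c x y * F x y = ∑ ω, F (f ω) (g ω) := by
    intro F
    have : ∀ x y, c x y * F x y = ∑ ω, if f ω = x ∧ g ω = y then F x y else 0 := by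
      intro x y
      rw [← Finset.sum_filter, Finset.sum_const, nsmul_eq_mul]
    simp_rw [this]
    have : ∀ x, ∑ y, ∑ ω, (if f ω = x ∧ g ω = y then F x y else 0)
        = ∑ ω, ∑ y, (if f ω = x ∧ g ω = y then F x y else 0) := fun x => Finset.sum_comm
    simp_rw [this]
    rw [Finset.sum_comm]
    refine Finset.sum_congr rfl fun ω _ => ?_
    simp [ite_and]
  have hsumd : ∑ y, d y = N := by
    have h := Finset.card_eq_sum_card_fiberwise (f := g) (s := (univ : Finset Ω))
      (t := (univ : Finset Y)) (by intro _ _; simp)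
    simp only [hd, hNdef]
    rw [← Nat.cast_sum, ← h, Finset.card_univ]
  have hterm : ∀ x y, (if c x y / N = 0 then 0 else
      c x y / N * Real.logb 2 ((d y / N) / (c x y / N)))
      ≤ c x y * (- Real.logb 2 (Q y x)) / N + (d y * Q y x / N - c x y / N) / Real.log 2 := by
    intro x y
    have hdn : 0 ≤ d y := Nat.cast_nonneg _
    by_cases h0 : c x y = 0
    · simp only [h0, zero_div, if_true, zero_mul, sub_zero, zero_add]
      have := hQ0 y x
      positivity
    · have hcpos : 0 < c x y := lt_of_le_of_ne (Nat.cast_nonneg _) (Ne.symm h0)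
      rw [if_neg (by positivity)]
      have hex : ∃ ω, f ω = x ∧ g ω = y := by
        by_contra hne
        push Not at hne
        apply h0
        simp only [hc]
        rw [Finset.filter_false_of_mem]
        · simp
        · intro ω _ h; exact hne ω h.1 h.2
      obtain ⟨ω, rfl, rfl⟩ := hex
      have hq := hQ ω
      have hcd : c (f ω) (g ω) ≤ d (g ω) := by
        simp only [hc, hd]
        exact_mod_cast Finset.card_le_card (fun a ha => by simp at ha ⊢; exact ha.2)
      have hdpos : 0 < d (g ω) := lt_of_lt_of_le hcpos hcd
      set q := Q (g ω) (f ω)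
      set cc := c (f ω) (g ω)
      set dd := d (g ω)
      have e1 : (dd / N) / (cc / N) = (dd * q / cc) / q := by field_simp
      rw [e1, Real.logb_div (by positivity) hq.ne']
      have hlog : Real.log (dd * q / cc) ≤ dd * q / cc - 1 :=
        Real.log_le_sub_one_of_pos (by positivity)
      have hlogb : Real.logb 2 (dd * q / cc) ≤ (dd * q / cc - 1) / Real.log 2 := by
        unfold Real.logb; gcongr
      have : cc / N * Real.logb 2 (dd * q / cc) ≤ cc / N * ((dd * q / cc - 1) / Real.log 2) := by
        gcongr
      have e2 : cc / N * ((dd * q / cc - 1) / Real.log 2)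
          = (dd * q / N - cc / N) / Real.log 2 := by field_simp
      have e3 : cc / N * (Real.logb 2 (dd * q / cc) - Real.logb 2 q)
          = cc * (-Real.logb 2 q) / N + cc / N * Real.logb 2 (dd * q / cc) := by ring
      rw [e3]
      linarith
  have hmain : condEntropy f g ≤ ∑ x, ∑ y, (c x y * (- Real.logb 2 (Q y x)) / N
      + (d y * Q y x / N - c x y / N) / Real.log 2) := by
    unfold condEntropy
    exact Finset.sum_le_sum fun x _ => Finset.sum_le_sum fun y _ => hterm x y
  refine hmain.trans ?_
  simp_rw [Finset.sum_add_distrib, ← Finset.sum_div, Finset.sum_sub_distrib, ← Finset.sum_div]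
  rw [hsumc fun x y => - Real.logb 2 (Q y x)]
  have h1 := hsumc fun _ _ => 1
  simp only [mul_one, Finset.sum_const, Finset.card_univ, nsmul_eq_mul] at h1
  rw [h1]
  have h2 : ∑ x, ∑ y, d y * Q y x ≤ N := by
    rw [Finset.sum_comm, ← hsumd]
    refine Finset.sum_le_sum fun y _ => ?_
    rw [← Finset.mul_sum]
    have hdn : 0 ≤ d y := Nat.cast_nonneg _
    nlinarith [hQ1 y]
  have h3 : ((∑ x, ∑ y, d y * Q y x) / N - N / N) / Real.log 2 ≤ 0 := by
    apply div_nonpos_of_nonpos_of_nonneg _ hl2.le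
    rw [← sub_div]
    exact div_nonpos_of_nonpos_of_nonneg (by linarith) hN.le
  linarith

/-- The parity check of an array. -/
def gam {n K : ℕ} (enc : Fin n → (Fin K → ZMod 2)) (y : Fin n → Bool) : Fin K → ZMod 2 :=
  ∑ l, if y l then enc l else 0

theorem gam_update {n K : ℕ} (enc : Fin n → (Fin K → ZMod 2)) (y : Fin n → Bool) (p : Fin n)
    (hy : gam enc y = 0) : gam enc (Function.update y p (!y p)) = enc p := by
  have h1 := Finset.add_sum_erase Finset.univ (fun l => if y l then enc l else 0)
    (Finset.mem_univ p)
  have h2 := Finset.add_sum_erase Finset.univ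
    (fun l => if (Function.update y p (!y p)) l then enc l else 0) (Finset.mem_univ p)
  have h3 : ∑ l ∈ Finset.univ.erase p,
      (if (Function.update y p (!y p)) l then enc l else 0)
      = ∑ l ∈ Finset.univ.erase p, (if y l then enc l else 0) := by
    refine Finset.sum_congr rfl fun l hl => ?_
    rw [Function.update_of_ne (Finset.ne_of_mem_erase hl)]
  rw [h3] at h2
  unfold gam at hy ⊢
  rw [hy] at h1
  rw [← h2]
  have hneg : -(enc p) = enc p := by
    funext i; simp only [Pi.neg_apply]; exact ZMod.neg_eq_self_mod_two _
  simp only [Function.update_self]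
  cases hp : y p
  · simp only [hp] at h1
    rw [if_neg (by simp), zero_add] at h1
    rw [h1, if_pos (by simp), add_zero]
  · simp only [hp] at h1
    rw [if_pos trivial] at h1
    rw [if_neg (by simp), zero_add, ← neg_eq_of_add_eq_zero_right h1, hneg]

/-- Number of zeros of an array. -/
def zer {n : ℕ} (y : Fin n → Bool) : ℕ := (Finset.univ.filter fun l => y l = false).card

/-- Injective cost refining the number of zeros. -/
noncomputable def cst {n : ℕ} (y : Fin n → Bool) : ℕ :=
  zer y * Fintype.card (Fin n → Bool) + (Fintype.equivFin (Fin n → Bool) y : ℕ)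

theorem cst_inj {n : ℕ} : Function.Injective (cst (n := n)) := by
  intro a b h
  have ha := (Fintype.equivFin (Fin n → Bool) a).2
  have hb := (Fintype.equivFin (Fin n → Bool) b).2
  unfold cst at h
  have h' := congrArg (· % Fintype.card (Fin n → Bool)) h
  simp only [Nat.mul_add_mod_self_right, Nat.mod_eq_of_lt ha, Nat.mod_eq_of_lt hb] at h'
  exact (Fintype.equivFin (Fin n → Bool)).injective (Fin.ext h')

theorem cst_lt {n : ℕ} {a b : Fin n → Bool} (h : zer a < zer b) : cst a < cst b := by
  have ha := (Fintype.equivFin (Fin n → Bool) a).2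
  unfold cst
  have : (zer a + 1) * Fintype.card (Fin n → Bool) ≤ zer b * Fintype.card (Fin n → Bool) :=
    Nat.mul_le_mul_right _ h
  rw [add_mul, one_mul] at this
  omega

/-- Completions of a partial array satisfying the parity check. -/
def good {n K : ℕ} (enc : Fin n → (Fin K → ZMod 2)) (α : Fin n → Option Bool)
    (w : Fin n → Bool) : Prop :=
  gam enc w = 0 ∧ ∀ l x, α l = some x → w l = x

theorem exists_canon {n K : ℕ} (enc : Fin n → (Fin K → ZMod 2)) (α : Fin n → Option Bool) :
    ∃ w : Fin n → Bool, (∃ y, good enc α y) →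
      good enc α w ∧ ∀ y, good enc α y → cst w ≤ cst y := by
  classical
  by_cases h : ∃ y, good enc α y
  · obtain ⟨y, hy⟩ := h
    obtain ⟨w, hw, hmin⟩ := Finset.exists_min_image (Finset.univ.filter (good enc α)) cst
      ⟨y, by simpa using hy⟩
    exact ⟨w, fun _ => ⟨by simpa using hw, fun z hz => hmin z (by simpa using hz)⟩⟩
  · exact ⟨fun _ => false, fun h' => absurd h' h⟩

/-- The optimal completion. -/
noncomputable def canon {n K : ℕ} (enc : Fin n → (Fin K → ZMod 2)) (α : Fin n → Option Bool) :
    Fin n → Bool := (exists_canon enc α).choose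

theorem canon_spec {n K : ℕ} (enc : Fin n → (Fin K → ZMod 2)) (α : Fin n → Option Bool)
    (h : ∃ y, good enc α y) : good enc α (canon enc α) ∧
      ∀ y, good enc α y → cst (canon enc α) ≤ cst y := (exists_canon enc α).choose_spec h

/-- The partial array that is zero off `S` and undefined on `S`. -/
def startOff {n : ℕ} (S : Finset (Fin n)) : Fin n → Option Bool :=
  fun l => if l ∈ S then none else some false

/-- The target array when `S` is the set of the late locations. -/
noncomputable def target {n K : ℕ} (enc : Fin n → (Fin K → ZMod 2)) (S : Finset (Fin n)) :
    Fin n → Bool := canon enc (startOff S)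

theorem target_spec {n K : ℕ} (enc : Fin n → (Fin K → ZMod 2)) (S : Finset (Fin n)) :
    good enc (startOff S) (target enc S) ∧
      ∀ y, good enc (startOff S) y → cst (target enc S) ≤ cst y := by
  apply canon_spec
  refine ⟨fun _ => false, ?_, ?_⟩
  · simp [gam]
  · intro l x hx
    unfold startOff at hx
    split_ifs at hx
    simpa using hx

theorem target_off {n K : ℕ} (enc : Fin n → (Fin K → ZMod 2)) (S : Finset (Fin n))
    (l : Fin n) (hl : l ∉ S) : target enc S l = false :=
  (target_spec enc S).1.2 l false (by simp [startOff, hl])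

theorem target_zeros {n K : ℕ} (enc : Fin n → (Fin K → ZMod 2)) (henc : Function.Injective enc)
    (S : Finset (Fin n)) : (S.filter fun l => target enc S l = false).card ≤ K := by
  classical
  by_contra hlt
  push Not at hlt
  set w := target enc S with hw
  set Z := S.filter fun l => w l = false with hZ
  have hcard : Module.finrank (ZMod 2) (Fin K → ZMod 2) < (Z.image enc).card := by
    rw [Finset.card_image_of_injective _ henc]; simpa using hlt
  obtain ⟨f, hf, e, heZ, hfe⟩ := Module.exists_nontrivial_relation_of_finrank_lt_card hcard
  rw [Finset.sum_image (fun a _ b _ h => henc h)] at hf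
  obtain ⟨p, hp, rfl⟩ := Finset.mem_image.1 heZ
  set y : Fin n → Bool := fun l => if l ∈ Z ∧ f (enc l) ≠ 0 then true else w l with hy
  have hwZ : ∀ l, l ∈ Z → w l = false := fun l hl => (Finset.mem_filter.1 hl).2
  have hgood : good enc (startOff S) y := by
    constructor
    · have h0 : gam enc w = 0 := (target_spec enc S).1.1
      have hsplit : gam enc y = gam enc w + ∑ l ∈ Z, f (enc l) • enc l := by
        unfold gam
        rw [← Finset.sum_filter_add_sum_filter_not Finset.univ (· ∈ Z)
            (fun l => if y l then enc l else 0),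
          ← Finset.sum_filter_add_sum_filter_not Finset.univ (· ∈ Z)
            (fun l => if w l then enc l else 0)]
        have e1 : ∑ l with l ∈ Z, (if w l then enc l else 0) = 0 := by
          refine Finset.sum_eq_zero fun l hl => ?_
          simp [hwZ l (by simpa using hl)]
        have e2 : ∑ l with l ∉ Z, (if y l then enc l else 0)
            = ∑ l with l ∉ Z, (if w l then enc l else 0) := by
          refine Finset.sum_congr rfl fun l hl => ?_
          have : l ∉ Z := by simpa using hl
          simp [hy, this]
        have e3 : ∑ l with l ∈ Z, (if y l then enc l else 0) = ∑ l ∈ Z, f (enc l) • enc l := by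
          have : (Finset.univ.filter (· ∈ Z)) = Z := by ext; simp
          rw [this]
          refine Finset.sum_congr rfl fun l hl => ?_
          by_cases h : f (enc l) = 0
          · simp [hy, hl, h, hwZ l hl]
          · have h1 : f (enc l) = 1 := by
              generalize f (enc l) = z at h
              revert h
              revert z
              decide
            simp [hy, hl, h1]
        rw [e1, e2, e3]; abel
      rw [hsplit, h0, hf, add_zero]
    · intro l x hx
      unfold startOff at hx
      split_ifs at hx with hS
      have : l ∉ Z := fun h => hS (Finset.mem_filter.1 h).1
      simp only [hy, this, false_and, if_false]
      rw [hw, target_off enc S l hS]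
      simpa using hx
  have hz : zer y < zer w := by
    apply Finset.card_lt_card
    rw [Finset.ssubset_iff_of_subset]
    · refine ⟨p, by simp [hwZ p hp], ?_⟩
      simp [hy, hp, hfe]
    · intro l hl
      simp only [Finset.mem_filter, Finset.mem_univ, true_and, hy] at hl ⊢
      split_ifs at hl
      exact hl
  exact absurd ((target_spec enc S).2 y hgood) (not_le.2 (cst_lt hz))

/-- The protocol. -/
noncomputable def proto {n K : ℕ} (enc : Fin n → (Fin K → ZMod 2)) (m : ℕ) :
    Fin n → (Fin n → Option Bool) → Bool :=
  fun l α => if m < (Finset.univ.filter fun i => α i = none).card then false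
    else canon enc α l

/-- The set of the last `m` locations. -/
def late {n : ℕ} (m : ℕ) (σ : Equiv.Perm (Fin n)) : Finset (Fin n) :=
  Finset.univ.filter fun l => n ≤ (σ.symm l : ℕ) + m

theorem part_proto {n K : ℕ} (enc : Fin n → (Fin K → ZMod 2)) (m : ℕ)
    (σ : Equiv.Perm (Fin n)) (t : ℕ) (ht : t ≤ n) :
    (partOO (proto enc m) σ t = fun l => if (σ.symm l : ℕ) < t then
      some (target enc (late m σ) l) else none) ∧
    ∀ h : t < n, proto enc m (σ ⟨t, h⟩) (fun l => if (σ.symm l : ℕ) < t then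
      some (target enc (late m σ) l) else none) = target enc (late m σ) (σ ⟨t, h⟩) := by
  classical
  have key : ∀ t, ∀ h : t < n, proto enc m (σ ⟨t, h⟩) (fun l => if (σ.symm l : ℕ) < t then
      some (target enc (late m σ) l) else none) = target enc (late m σ) (σ ⟨t, h⟩) := by
    intro t h
    have hcard : (Finset.univ.filter fun l : Fin n => (if (σ.symm l : ℕ) < t then
      some (target enc (late m σ) l) else none) = none).card = n - t := by
      have : (Finset.univ.filter fun l : Fin n => (if (σ.symm l : ℕ) < t then
          some (target enc (late m σ) l) else none) = none)
          = (Finset.Ici (⟨t, h⟩ : Fin n)).map σ.toEmbedding := by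
        ext l
        simp [Finset.mem_map_equiv, Fin.le_def]
      rw [this, Finset.card_map, Fin.card_Ici]
    unfold proto
    rw [hcard]
    split_ifs with hm
    · rw [target_off]
      simp [late]; omega
    · set w := target enc (late m σ) with hw
      set α : Fin n → Option Bool := fun l => if (σ.symm l : ℕ) < t then some (w l) else none
        with hα
      have hgw : good enc α w := by
        refine ⟨(target_spec enc _).1.1, fun l x hx => ?_⟩
        simp only [hα] at hx
        split_ifs at hx
        simpa using hx
      obtain ⟨hg, hmin⟩ := canon_spec enc α ⟨w, hgw⟩
      have hg' : good enc (startOff (late m σ)) (canon enc α) := by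
        refine ⟨hg.1, fun l x hx => ?_⟩
        unfold startOff at hx
        split_ifs at hx with hl
        have hlt : (σ.symm l : ℕ) < t := by
          simp [late] at hl; omega
        rw [hg.2 l (w l) (by simp [hα, hlt]), hw, target_off _ _ _ hl]
        simpa using hx
      have : canon enc α = w :=
        cst_inj (le_antisymm (hmin w hgw) ((target_spec enc _).2 _ hg'))
      rw [this]
  refine ⟨?_, key t⟩
  induction t with
  | zero => funext l; simp [partOO]
  | succ t ih =>
    have h : t < n := ht
    rw [partOO, dif_pos h, ih h.le, key t h]
    funext l
    by_cases hl : l = σ ⟨t, h⟩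
    · subst hl; simp
    · rw [Function.update_of_ne hl]
      have : (σ.symm l : ℕ) ≠ t := by
        intro h'
        apply hl
        rw [← σ.symm_apply_eq]
        exact Fin.ext h'
      have h2 : (σ.symm l : ℕ) < t + 1 ↔ (σ.symm l : ℕ) < t := by omega
      simp only [h2]

theorem comp_proto {n K : ℕ} (enc : Fin n → (Fin K → ZMod 2)) (m : ℕ)
    (σ : Equiv.Perm (Fin n)) (hn : n - 1 < n) (b : Bool) :
    compOO (proto enc m) σ b
      = Function.update (target enc (late m σ)) (σ ⟨n - 1, hn⟩) b := by
  funext l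
  unfold compOO
  by_cases hl : l = σ ⟨n - 1, hn⟩
  · subst hl; simp
  · rw [Function.update_of_ne hl, if_neg]
    · obtain ⟨h1, h2⟩ := part_proto enc m σ (σ.symm l : ℕ) (σ.symm l).2.le
      unfold writeOO
      rw [h1]
      have := h2 (σ.symm l).2
      simpa using this
    · intro h'
      apply hl
      rw [← σ.symm_apply_eq]
      exact Fin.ext h'

theorem late_swap {n m : ℕ} (σ : Equiv.Perm (Fin n)) (i j : Fin n) (hi : n ≤ (i : ℕ) + m)
    (hj : n ≤ (j : ℕ) + m) : late m (σ * Equiv.swap i j) = late m σ := by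
  ext l
  have : (σ * Equiv.swap i j).symm l = Equiv.swap i j (σ.symm l) := by
    rw [Equiv.symm_apply_eq]; simp
  simp only [late, Finset.mem_filter, Finset.mem_univ, true_and, this]
  rw [Equiv.swap_apply_def]
  split_ifs with h1 h2
  · rw [h1]; tauto
  · rw [h2]; tauto
  · rfl

theorem late_card {n m : ℕ} (hm : m ≤ n) (hm0 : 0 < m) (σ : Equiv.Perm (Fin n)) :
    (late m σ).card = m := by
  have : late m σ = (Finset.Ici (⟨n - m, by omega⟩ : Fin n)).map σ.toEmbedding := by
    ext l
    simp [late, Finset.mem_map_equiv, Fin.le_def]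
  rw [this, Finset.card_map, Fin.card_Ici]
  simp; omega

theorem bad_count {n K m : ℕ} (enc : Fin n → (Fin K → ZMod 2)) (henc : Function.Injective enc)
    (hm : m ≤ n) (hm0 : 0 < m) (hn : n - 1 < n) :
    m * (Finset.univ.filter fun σ : Equiv.Perm (Fin n) =>
      target enc (late m σ) (σ ⟨n - 1, hn⟩) = false).card
      ≤ K * Fintype.card (Equiv.Perm (Fin n)) := by
  classical
  set J : Finset (Fin n) := Finset.Ici (⟨n - m, by omega⟩ : Fin n) with hJ
  have hJc : J.card = m := by rw [hJ, Fin.card_Ici]; simp; omega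
  have hJm : ∀ j ∈ J, n ≤ (j : ℕ) + m := by
    intro j hj
    simp [hJ, Fin.le_def] at hj
    omega
  have hsame : ∀ j ∈ J, (Finset.univ.filter fun σ : Equiv.Perm (Fin n) =>
      target enc (late m σ) (σ ⟨n - 1, hn⟩) = false).card
      = (Finset.univ.filter fun σ : Equiv.Perm (Fin n) =>
      target enc (late m σ) (σ j) = false).card := by
    intro j hj
    have hl : n ≤ ((⟨n - 1, hn⟩ : Fin n) : ℕ) + m := by simp; omega
    refine Finset.card_bij' (fun σ _ => σ * Equiv.swap ⟨n - 1, hn⟩ j)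
      (fun σ _ => σ * Equiv.swap ⟨n - 1, hn⟩ j) ?_ ?_ ?_ ?_
    · intro σ hσ
      simp only [Finset.mem_filter, Finset.mem_univ, true_and] at hσ ⊢
      rw [late_swap σ _ _ hl (hJm j hj)]
      simpa using hσ
    · intro σ hσ
      simp only [Finset.mem_filter, Finset.mem_univ, true_and] at hσ ⊢
      rw [late_swap σ _ _ hl (hJm j hj)]
      simpa using hσ
    · intro σ _; simp [mul_assoc]
    · intro σ _; simp [mul_assoc]
  calc m * (Finset.univ.filter fun σ : Equiv.Perm (Fin n) =>
      target enc (late m σ) (σ ⟨n - 1, hn⟩) = false).card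
      = ∑ j ∈ J, (Finset.univ.filter fun σ : Equiv.Perm (Fin n) =>
      target enc (late m σ) (σ j) = false).card := by
        rw [← Finset.sum_congr rfl hsame, Finset.sum_const, hJc, smul_eq_mul]
    _ = ∑ σ : Equiv.Perm (Fin n),
        (J.filter fun j => target enc (late m σ) (σ j) = false).card := by
        simp_rw [Finset.card_filter]
        rw [Finset.sum_comm]
    _ ≤ ∑ σ : Equiv.Perm (Fin n), K := by
        refine Finset.sum_le_sum fun σ _ => ?_
        refine le_trans ?_ (target_zeros enc henc (late m σ))
        refine Finset.card_le_card_of_injOn σ ?_ σ.injective.injOn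
        intro j hj
        have hj' := Finset.mem_filter.1 hj
        simp only [Finset.coe_filter, Set.mem_ofPred_eq]
        exact ⟨by simpa [late] using hJm j hj'.1, hj'.2⟩
    _ = K * Fintype.card (Equiv.Perm (Fin n)) := by
        simp [mul_comm]

theorem exists_enc {n K : ℕ} (h : n < 2 ^ K) :
    ∃ enc : Fin n → (Fin K → ZMod 2), Function.Injective enc ∧ ∀ l, enc l ≠ 0 := by
  classical
  have hc : Fintype.card (Fin n) ≤ Fintype.card {v : Fin K → ZMod 2 // v ≠ 0} := by
    rw [Fintype.card_subtype_compl]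
    simp
    omega
  obtain ⟨e⟩ := Function.Embedding.nonempty_of_card_le hc
  exact ⟨fun l => (e l).1, fun a b h => e.injective (Subtype.ext h), fun l => (e l).2⟩

/-- Bob's predictive distribution. -/
noncomputable def pred {n K : ℕ} (enc : Fin n → (Fin K → ZMod 2)) (m : ℕ) (y : Fin n → Bool)
    (x : Fin n) : ℝ :=
  if gam enc y = 0 then
    if y x = true ∧ (Finset.univ.filter fun l => y l = true).card ≤ m then 1 / (2 * m : ℝ)
    else 1 / (2 * n : ℝ)
  else if enc x = gam enc y then 1 else 0

theorem pred_sum {n K m : ℕ} (enc : Fin n → (Fin K → ZMod 2)) (henc : Function.Injective enc)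
    (hm0 : 0 < m) (hn : 0 < n) (y : Fin n → Bool) : ∑ x, pred enc m y x ≤ 1 := by
  classical
  have hm' : (0 : ℝ) < m := by exact_mod_cast hm0
  have hn' : (0 : ℝ) < n := by exact_mod_cast hn
  unfold pred
  split_ifs with h
  · have hle : ∀ x, (if y x = true ∧ (Finset.univ.filter fun l => y l = true).card ≤ m
        then 1 / (2 * m : ℝ) else 1 / (2 * n : ℝ)) ≤
        (if y x = true ∧ (Finset.univ.filter fun l => y l = true).card ≤ m
        then 1 / (2 * m : ℝ) else 0) + 1 / (2 * n : ℝ) := by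
      intro x
      split_ifs
      · have : 0 < 1 / (2 * n : ℝ) := by positivity
        linarith
      · simp
    refine (Finset.sum_le_sum fun x _ => hle x).trans ?_
    rw [Finset.sum_add_distrib]
    have h1 : ∑ x : Fin n, 1 / (2 * n : ℝ) = 1 / 2 := by
      simp; field_simp
    have h2 : ∑ x, (if y x = true ∧ (Finset.univ.filter fun l => y l = true).card ≤ m
        then 1 / (2 * m : ℝ) else 0) ≤ 1 / 2 := by
      by_cases hc : (Finset.univ.filter fun l => y l = true).card ≤ m
      · simp only [hc, and_true]
        rw [← Finset.sum_filter, Finset.sum_const, nsmul_eq_mul]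
        have hc' : ((Finset.univ.filter fun l => y l = true).card : ℝ) ≤ m := by
          exact_mod_cast hc
        calc _ ≤ (m : ℝ) * (1 / (2 * m)) := by gcongr
          _ = 1 / 2 := by field_simp
      · simp [hc]
    linarith
  · by_cases hx : ∃ x, enc x = gam enc y
    · obtain ⟨x, hx⟩ := hx
      rw [← hx]
      simp [henc.eq_iff]
    · push Not at hx
      simp [hx]

theorem main_bound {n K m : ℕ} (hn : 2 ≤ n) (hlast : n - 1 < n) (enc : Fin n → (Fin K → ZMod 2))
    (henc : Function.Injective enc) (hne : ∀ l, enc l ≠ 0) (hm : m ≤ n) (hm0 : 0 < m) :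
    condEntropy (fun ω : Equiv.Perm (Fin n) × Bool => ω.1 ⟨n - 1, hlast⟩)
          (fun ω : Equiv.Perm (Fin n) × Bool => compOO (proto enc m) ω.1 ω.2) ≤
      (1 + Real.logb 2 m + K / m * Real.logb 2 n) / 2 := by
  classical
  have hm' : (0 : ℝ) < m := by exact_mod_cast hm0
  have hn' : (0 : ℝ) < n := by exact_mod_cast (by omega : 0 < n)
  have hlm : 0 ≤ Real.logb 2 m := Real.logb_nonneg (by norm_num) (by exact_mod_cast hm0)
  have hln : 0 ≤ Real.logb 2 n :=
    Real.logb_nonneg (by norm_num) (by exact_mod_cast (by omega : 1 ≤ n))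
  have hw0 : ∀ σ : Equiv.Perm (Fin n), gam enc (target enc (late m σ)) = 0 :=
    fun σ => (target_spec enc _).1.1
  have hsupp : ∀ σ : Equiv.Perm (Fin n),
      (Finset.univ.filter fun l => target enc (late m σ) l = true).card ≤ m := by
    intro σ
    conv_rhs => rw [← late_card hm hm0 σ]
    refine Finset.card_le_card fun l hl => ?_
    by_contra hl'
    have := target_off enc _ l hl'
    simp [this] at hl
  -- value of the prediction on the two final bits
  have hflip : ∀ σ : Equiv.Perm (Fin n),
      pred enc m (compOO (proto enc m) σ (!target enc (late m σ) (σ ⟨n - 1, hlast⟩)))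
        (σ ⟨n - 1, hlast⟩) = 1 := by
    intro σ
    rw [comp_proto enc m σ hlast]
    unfold pred
    rw [gam_update enc _ _ (hw0 σ), if_neg (hne _), if_pos rfl]
  have hkeep : ∀ σ : Equiv.Perm (Fin n),
      pred enc m (compOO (proto enc m) σ (target enc (late m σ) (σ ⟨n - 1, hlast⟩)))
        (σ ⟨n - 1, hlast⟩) = if target enc (late m σ) (σ ⟨n - 1, hlast⟩) = false
          then 1 / (2 * n : ℝ) else 1 / (2 * m : ℝ) := by
    intro σ
    rw [comp_proto enc m σ hlast, Function.update_eq_self]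
    unfold pred
    rw [if_pos (hw0 σ)]
    have := hsupp σ
    cases h : target enc (late m σ) (σ ⟨n - 1, hlast⟩)
    · simp
    · simp [this]
  have hpos : ∀ ω : Equiv.Perm (Fin n) × Bool,
      0 < pred enc m (compOO (proto enc m) ω.1 ω.2) (ω.1 ⟨n - 1, hlast⟩) := by
    rintro ⟨σ, b⟩
    by_cases hb : b = target enc (late m σ) (σ ⟨n - 1, hlast⟩)
    · simp only [hb]
      rw [hkeep]
      split_ifs <;> positivity
    · have hb' : b = !target enc (late m σ) (σ ⟨n - 1, hlast⟩) := by
        revert hb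
        cases b <;> cases target enc (late m σ) (σ ⟨n - 1, hlast⟩) <;> simp
      simp only [hb']
      rw [hflip]; norm_num
  refine (condEntropy_le_cost _ _ (pred enc m) ?_ (pred_sum enc henc hm0 (by omega)) hpos).trans ?_
  · intro y x
    unfold pred
    split_ifs <;> positivity
  have hsum : ∀ σ : Equiv.Perm (Fin n), ∑ b : Bool,
      - Real.logb 2 (pred enc m (compOO (proto enc m) σ b) (σ ⟨n - 1, hlast⟩))
      ≤ (1 + Real.logb 2 m) + if target enc (late m σ) (σ ⟨n - 1, hlast⟩) = false then
        Real.logb 2 n else 0 := by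
    intro σ
    have e : ∀ F : Bool → ℝ, ∑ b, F b = F (target enc (late m σ) (σ ⟨n - 1, hlast⟩))
        + F (!target enc (late m σ) (σ ⟨n - 1, hlast⟩)) := by
      intro F
      cases target enc (late m σ) (σ ⟨n - 1, hlast⟩) <;> simp [add_comm]
    rw [e, hkeep, hflip]
    have hl : ∀ a : ℝ, 0 < a → - Real.logb 2 (1 / (2 * a)) = 1 + Real.logb 2 a := by
      intro a ha
      rw [one_div, Real.logb_inv, Real.logb_mul (by norm_num) ha.ne',
        Real.logb_self_eq_one (by norm_num)]
      ring
    rw [Real.logb_one]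
    split_ifs
    · rw [hl _ hn']; linarith
    · rw [hl _ hm']; linarith
  rw [Fintype.sum_prod_type]
  set P : ℝ := (Fintype.card (Equiv.Perm (Fin n)) : ℝ) with hP
  have hPpos : 0 < P := by rw [hP]; exact_mod_cast Fintype.card_pos
  set c : ℕ := (Finset.univ.filter fun σ : Equiv.Perm (Fin n) =>
      target enc (late m σ) (σ ⟨n - 1, hlast⟩) = false).card with hc
  have hbad : (m : ℝ) * c ≤ K * P := by
    rw [hP]; exact_mod_cast bad_count enc henc hm hm0 hlast
  have htot : ∑ σ : Equiv.Perm (Fin n), ∑ b : Bool,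
      - Real.logb 2 (pred enc m (compOO (proto enc m) σ b) (σ ⟨n - 1, hlast⟩))
      ≤ P * (1 + Real.logb 2 m) + c * Real.logb 2 n := by
    refine (Finset.sum_le_sum fun σ _ => hsum σ).trans ?_
    rw [Finset.sum_add_distrib, ← Finset.sum_filter, Finset.sum_const, Finset.sum_const,
      nsmul_eq_mul, nsmul_eq_mul, Finset.card_univ]
  have hcle : (c : ℝ) ≤ K / m * P := by
    rw [div_mul_eq_mul_div, le_div_iff₀ hm']; linarith
  have hcard : (Fintype.card (Equiv.Perm (Fin n) × Bool) : ℝ) = P * 2 := by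
    rw [Fintype.card_prod]; push_cast; simp [hP]
  rw [hcard, div_le_iff₀ (by positivity)]
  have : (c : ℝ) * Real.logb 2 n ≤ K / m * P * Real.logb 2 n := by gcongr
  refine htot.trans ?_
  nlinarith

theorem small_bound {n : ℕ} (hn : 2 ≤ n) (hlast : n - 1 < n) (B : Fin n → (Fin n → Option Bool) → Bool) :
    condEntropy (fun ω : Equiv.Perm (Fin n) × Bool => ω.1 ⟨n - 1, hlast⟩)
          (fun ω : Equiv.Perm (Fin n) × Bool => compOO B ω.1 ω.2) ≤ Real.logb 2 n := by
  have hn' : (0 : ℝ) < n := by exact_mod_cast (by omega : 0 < n)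
  refine (condEntropy_le_cost _ _ (fun _ _ => 1 / (n : ℝ)) ?_ ?_ ?_).trans ?_
  · intro _ _; positivity
  · intro _; simp; field_simp; rfl
  · intro _; positivity
  · have hP : (0 : ℝ) < Fintype.card (Equiv.Perm (Fin n) × Bool) := by
      exact_mod_cast Fintype.card_pos
    rw [Finset.sum_const, Finset.card_univ, nsmul_eq_mul, one_div, Real.logb_inv, neg_neg,
      mul_div_assoc, mul_comm, div_mul_cancel₀ _ hP.ne']

theorem logb_le_of_le_pow {n k : ℕ} (hn : 2 ≤ n) (h : n ≤ 2 ^ k) : Real.logb 2 (n : ℝ) ≤ k := by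
  have hn' : (0 : ℝ) < n := by exact_mod_cast (by omega : 0 < n)
  rw [Real.logb_le_iff_le_rpow (by norm_num) hn', Real.rpow_natCast]
  exact_mod_cast h

theorem lt_ceil_loglog {n k : ℕ} (h : 2 ^ (2 ^ k) < n) :
    ((k : ℝ) + 1) ≤ (⌈Real.logb 2 (Real.logb 2 (n : ℝ))⌉₊ : ℝ) := by
  have hn' : (0 : ℝ) < n := by exact_mod_cast (lt_of_le_of_lt (Nat.zero_le _) h : 0 < n)
  have h1 : ((2 ^ k : ℕ) : ℝ) < Real.logb 2 (n : ℝ) := by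
    rw [Real.lt_logb_iff_rpow_lt (by norm_num) hn', Real.rpow_natCast]
    exact_mod_cast h
  have h0 : (0 : ℝ) < ((2 ^ k : ℕ) : ℝ) := by positivity
  have h2 : (k : ℝ) < Real.logb 2 (Real.logb 2 (n : ℝ)) := by
    rw [Real.lt_logb_iff_rpow_lt (by norm_num) (h0.trans h1), Real.rpow_natCast]
    exact_mod_cast h1
  have h3 : k < ⌈Real.logb 2 (Real.logb 2 (n : ℝ))⌉₊ := Nat.lt_ceil.2 h2
  exact_mod_cast h3

/-- there is an order-oblivious protocol for `G_n` such that the conditional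
entropy of the last location `σ (n-1)` given Alice's completed array (under a uniformly
random permutation `σ` and uniform bit `b`) is at most `3 + ⌈log₂ log₂ n⌉`. -/
theorem exists_low_entropy_protocol {n : ℕ} (hn : 2 ≤ n) :
    ∃ B : Fin n → (Fin n → Option Bool) → Bool,
      condEntropy (fun ω : Equiv.Perm (Fin n) × Bool => ω.1 ⟨n - 1, by omega⟩)
          (fun ω : Equiv.Perm (Fin n) × Bool => compOO B ω.1 ω.2) ≤
        3 + (⌈Real.logb 2 (Real.logb 2 (n : ℝ))⌉₊ : ℝ) := by
  by_cases hsmall : n ≤ 64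
  · refine ⟨fun _ _ => false, (small_bound hn _ _).trans ?_⟩
    have hc0 : (0 : ℝ) ≤ (⌈Real.logb 2 (Real.logb 2 (n : ℝ))⌉₊ : ℝ) := Nat.cast_nonneg _
    by_cases h8 : n ≤ 8
    · have := logb_le_of_le_pow (k := 3) hn (by omega)
      push_cast at this
      linarith
    by_cases h32 : n ≤ 32
    · have := logb_le_of_le_pow (k := 5) hn (by omega)
      have h2 := lt_ceil_loglog (n := n) (k := 1) (by norm_num; omega)
      push_cast at this h2
      linarith
    · have := logb_le_of_le_pow (k := 6) hn (by omega)
      have h2 := lt_ceil_loglog (n := n) (k := 2) (by norm_num; omega)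
      push_cast at this h2
      linarith
  · push Not at hsmall
    obtain ⟨k, hk⟩ : ∃ k, k = Nat.log 2 n := ⟨_, rfl⟩
    have hlow : 2 ^ k ≤ n := hk ▸ Nat.pow_log_le_self 2 (by omega)
    have hhigh : n < 2 ^ (k + 1) := hk ▸ Nat.lt_pow_succ_log_self (by norm_num) n
    have hk6 : 6 ≤ k := by
      by_contra hlt
      have : 2 ^ (k + 1) ≤ 2 ^ 6 := Nat.pow_le_pow_right (by norm_num) (by omega)
      omega
    have hsq : (k + 1) * (k + 1) ≤ 2 ^ k := by
      clear hk hlow hhigh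
      induction k, hk6 using Nat.le_induction with
      | base => norm_num
      | succ j hj ih => rw [pow_succ]; nlinarith
    obtain ⟨enc, henc, hne⟩ := exists_enc hhigh
    refine ⟨proto enc ((k + 1) * (k + 1)), (main_bound hn _ enc henc hne (hsq.trans hlow)
      (by positivity)).trans ?_⟩
    have hK : (0 : ℝ) < (k : ℝ) + 1 := by positivity
    have hL1 : Real.logb 2 (n : ℝ) ≤ (k : ℝ) + 1 := by
      have := logb_le_of_le_pow hn hhigh.le
      exact_mod_cast this
    have hn' : (0 : ℝ) < n := by exact_mod_cast (by omega : 0 < n)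
    have hL2 : (k : ℝ) ≤ Real.logb 2 (n : ℝ) := by
      rw [Real.le_logb_iff_rpow_le (by norm_num) hn', Real.rpow_natCast]
      exact_mod_cast hlow
    have hk6' : (6 : ℝ) ≤ k := by exact_mod_cast hk6
    have hLpos : 0 < Real.logb 2 (n : ℝ) := by linarith
    have hKL : Real.logb 2 ((k : ℝ) + 1) ≤ 1 + Real.logb 2 (Real.logb 2 (n : ℝ)) := by
      have : Real.logb 2 ((k : ℝ) + 1) ≤ Real.logb 2 (2 * Real.logb 2 (n : ℝ)) :=
        Real.logb_le_logb_of_le (by norm_num) hK (by linarith)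
      rwa [Real.logb_mul (by norm_num) hLpos.ne', Real.logb_self_eq_one (by norm_num)] at this
    have hceil := Nat.le_ceil (Real.logb 2 (Real.logb 2 (n : ℝ)))
    push_cast
    rw [Real.logb_mul hK.ne' hK.ne']
    have hfrac : ((k : ℝ) + 1) / (((k : ℝ) + 1) * ((k : ℝ) + 1)) * Real.logb 2 (n : ℝ) ≤ 1 := by
      rw [div_mul_eq_mul_div, div_le_one (by positivity)]
      gcongr
    linarith
end
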